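/- Let ι be a (ground) type and for each e ∈ ι let M_e be an n×n Hermitian positive semidefinite complex matrix. Define the set function R : Finset ι → ℝ by R(U) := log((det(I_n + Σ_{e∈U} M_e)).re). Then R is a submodular set function, R is monotone, and R is normalized (R(∅) = 0). In the paper's setting, M_e = p_e H W_e W_e† H† with p_e ≥ 0, so the per-user rate U ↦ log|I + Σ_{e∈U} p_e H W_e W_e† H†| is a normalized monotone submodular set function. -/

import Mathlib

open Matrix
open scoped ComplexOrder

/-- A set function f : Finset ι → ℝ is submodular if
f(U ∪ {e}) − f(U) ≥ f(U' ∪ {e}) − f(U') for all U ⊆ U' and all e ∉ U'. -/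
def Submodular {ι : Type*} [DecidableEq ι] (f : Finset ι → ℝ) : Prop :=
  ∀ U U' : Finset ι, U ⊆ U' → ∀ e ∉ U',
    f (insert e U) - f U ≥ f (insert e U') - f U'

/-- A set function f : Finset ι → ℝ is monotone if U ⊆ U' implies f(U) ≤ f(U'). -/
def MonotoneSetFn {ι : Type*} (f : Finset ι → ℝ) : Prop :=
  ∀ U U' : Finset ι, U ⊆ U' → f U ≤ f U'

open scoped MatrixOrder in
theorem aux_factor {n : ℕ} {Q : Matrix (Fin n) (Fin n) ℂ} (hQ : Q.PosSemidef) :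
    ∃ W : Matrix (Fin n) (Fin n) ℂ, Q = W * Wᴴ := by
  obtain ⟨B, hB⟩ := CStarAlgebra.nonneg_iff_eq_mul_star_self.mp hQ.nonneg
  exact ⟨B, hB⟩

theorem aux_one_le {n : ℕ} {S : Matrix (Fin n) (Fin n) ℂ} (hS : S.PosSemidef) :
    1 ≤ (1 + S).det := by
  have h := hS.1.spectral_theorem
  rw [Unitary.conjStarAlgAut_apply] at h
  rw [h, Matrix.det_one_add_mul_comm, ← mul_assoc, Unitary.coe_star_mul_self, one_mul,
    ← Matrix.diagonal_one, Matrix.diagonal_add, Matrix.det_diagonal]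
  have : (∏ i, (1 + ((RCLike.ofReal ∘ hS.1.eigenvalues) i : ℂ)))
      = ((∏ i, (1 + hS.1.eigenvalues i) : ℝ) : ℂ) := by
    push_cast; rfl
  rw [this]
  have h1 : (1 : ℝ) ≤ ∏ i, (1 + hS.1.eigenvalues i) := by
    calc (1 : ℝ) = ∏ i : Fin n, (1 : ℝ) := by simp
      _ ≤ _ := Finset.prod_le_prod (fun _ _ => zero_le_one)
        (fun i _ => by linarith [hS.eigenvalues_nonneg i])
  exact_mod_cast h1

theorem aux_det_le {n : ℕ} {P Q : Matrix (Fin n) (Fin n) ℂ} (hP : P.PosDef)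
    (hQ : Q.PosSemidef) : P.det ≤ (P + Q).det := by
  obtain ⟨W, rfl⟩ := aux_factor hQ
  rw [Matrix.det_add_mul _ _ ((Matrix.isUnit_iff_isUnit_det _).mp hP.isUnit)]
  have := aux_one_le (hP.inv.posSemidef.conjTranspose_mul_mul_same W)
  exact le_mul_of_one_le_right hP.det_pos.le this

theorem aux_inv {n : ℕ} {A B : Matrix (Fin n) (Fin n) ℂ} (hA : A.PosDef)
    (hB : B.PosSemidef) : (A⁻¹ - (A + B)⁻¹).PosSemidef := by
  have hAB := hA.add_posSemidef hB
  haveI := hAB.isUnit.invertible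
  haveI := hA.inv.isUnit.invertible
  have h1 := Matrix.PosDef.fromBlocks₁₁ (1 : Matrix (Fin n) (Fin n) ℂ) A⁻¹ hAB
  have h2 := Matrix.PosDef.fromBlocks₂₂ (A + B) (1 : Matrix (Fin n) (Fin n) ℂ) hA.inv
  rw [h1] at h2
  simpa [Matrix.nonsing_inv_nonsing_inv _ ((Matrix.isUnit_iff_isUnit_det _).mp hA.isUnit), hB]
    using h2

theorem aux_main {n : ℕ} {A B C : Matrix (Fin n) (Fin n) ℂ} (hA : A.PosDef)
    (hB : B.PosSemidef) (hC : C.PosSemidef) :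
    (A + B + C).det * A.det ≤ (A + C).det * (A + B).det := by
  have hAB := hA.add_posSemidef hB
  obtain ⟨W, rfl⟩ := aux_factor hC
  rw [Matrix.det_add_mul _ _ ((Matrix.isUnit_iff_isUnit_det _).mp hA.isUnit),
    Matrix.det_add_mul _ _ ((Matrix.isUnit_iff_isUnit_det _).mp hAB.isUnit)]
  have h1 := (aux_inv hA hB).conjTranspose_mul_mul_same W
  have h2 := aux_det_le
    (Matrix.PosDef.one.add_posSemidef (hAB.inv.posSemidef.conjTranspose_mul_mul_same W)) h1
  have h3 : 1 + Wᴴ * (A + B)⁻¹ * W + Wᴴ * (A⁻¹ - (A + B)⁻¹) * W = 1 + Wᴴ * A⁻¹ * W := by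
    noncomm_ring
  rw [h3] at h2
  have h4 := mul_le_mul_of_nonneg_left h2 (mul_pos hA.det_pos hAB.det_pos).le
  calc _ = A.det * (A + B).det * (1 + Wᴴ * (A + B)⁻¹ * W).det := by ring
    _ ≤ _ := h4
    _ = _ := by ring

theorem aux_re {z w : ℂ} (hz : 0 < z) (hw : 0 < w) : (z * w).re = z.re * w.re := by
  have := (Complex.lt_def.mp hz).2
  simp at this
  simp [Complex.mul_re, ← this]

/-- For Hermitian positive semidefinite matrices M_e, the set function
R(U) := log((det(I_n + Σ_{e∈U} M_e)).re) is submodular, monotone, and normalized. -/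
theorem logdet_rate_submodular {ι : Type*} [DecidableEq ι] {n : ℕ}
    (M : ι → Matrix (Fin n) (Fin n) ℂ) (hM : ∀ e, (M e).PosSemidef) :
    Submodular (fun U : Finset ι =>
      Real.log (((1 : Matrix (Fin n) (Fin n) ℂ) + ∑ e ∈ U, M e).det.re)) ∧
    MonotoneSetFn (fun U : Finset ι =>
      Real.log (((1 : Matrix (Fin n) (Fin n) ℂ) + ∑ e ∈ U, M e).det.re)) ∧
    Real.log (((1 : Matrix (Fin n) (Fin n) ℂ) + ∑ e ∈ (∅ : Finset ι), M e).det.re) = 0 := by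
  have hpd : ∀ U : Finset ι, ((1 : Matrix (Fin n) (Fin n) ℂ) + ∑ e ∈ U, M e).PosDef := fun U =>
    Matrix.PosDef.one.add_posSemidef (Matrix.posSemidef_sum U fun e _ => hM e)
  have hpos : ∀ U : Finset ι, 0 < ((1 : Matrix (Fin n) (Fin n) ℂ) + ∑ e ∈ U, M e).det.re :=
    fun U => (Complex.lt_def.mp (hpd U).det_pos).1
  have hsplit : ∀ U U' : Finset ι, U ⊆ U' → (1 : Matrix (Fin n) (Fin n) ℂ) + ∑ e ∈ U', M e
      = (1 + ∑ e ∈ U, M e) + ∑ e ∈ U' \ U, M e := by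
    intro U U' h
    rw [← Finset.sum_sdiff h]; abel
  refine ⟨?_, ?_, by simp⟩
  · intro U U' h e he
    have heU : e ∉ U := fun h' => he (h h')
    have key := aux_main (hpd U) (Matrix.posSemidef_sum (U' \ U) fun e _ => hM e) (hM e)
    rw [← hsplit U U' h] at key
    have e1 : ∀ V : Finset ι, e ∉ V → (1 : Matrix (Fin n) (Fin n) ℂ) + ∑ e ∈ V, M e + M e
        = 1 + ∑ e ∈ insert e V, M e := by
      intro V hV
      rw [Finset.sum_insert hV]; abel
    rw [e1 _ he, e1 _ heU] at key
    have k2 := (Complex.le_def.mp key).1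
    rw [aux_re (hpd _).det_pos (hpd _).det_pos, aux_re (hpd _).det_pos (hpd _).det_pos] at k2
    have k3 := Real.log_le_log (mul_pos (hpos _) (hpos _)) k2
    rw [Real.log_mul (hpos _).ne' (hpos _).ne', Real.log_mul (hpos _).ne' (hpos _).ne'] at k3
    show _ ≤ _
    linarith
  · intro U U' h
    apply Real.log_le_log (hpos U)
    rw [hsplit U U' h]
    exact (Complex.le_def.mp
      (aux_det_le (hpd U) (Matrix.posSemidef_sum (U' \ U) fun e _ => hM e))).1
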